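/- The lazy simple random walk on the infinite dihedral group D∞ = ⟨a,b | a² = b² = 1⟩, with step measure μ(1) = μ(a) = μ(b) = 1/3, is noise sensitive in average distance with respect to the word metric of the generating set {a,b}: for every ρ ∈ (0,1), liminf_n E d(X_n,Y_n^ρ)/E d(X_n,X'_n) ≥ 1. -/

import Mathlib

open Filter

namespace NS

/-- A probability measure on a countable (discrete) set, as a nonnegative
function summing to 1. -/
def IsProbMeasure {E : Type*} (ξ : E → ℝ) : Prop :=
  (∀ x, 0 ≤ ξ x) ∧ ∑' x, ξ x = 1

/-- Convolution of two measures on a group. -/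
noncomputable def conv {G : Type*} [Group G] (μ ν : G → ℝ) : G → ℝ :=
  fun g => ∑' h, μ h * ν (h⁻¹ * g)

/-- `convPow μ n` is the `n`-fold convolution `μ^{*n}`, the law of the random
walk at time `n` (with `μ^{*0}` the Dirac mass at the identity). -/
noncomputable def convPow {G : Type*} [Group G] (μ : G → ℝ) : ℕ → G → ℝ
  | 0 => ({1} : Set G).indicator (fun _ => (1 : ℝ))
  | n + 1 => conv μ (convPow μ n)

/-- The diagonal measure `μ^diag` on `G × G`. -/
noncomputable def diagM {G : Type*} [Group G] (μ : G → ℝ) : G × G → ℝ :=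
  {p : G × G | p.1 = p.2}.indicator (fun p => μ p.1)

/-- Product of two measures. -/
def prodM {G H : Type*} (μ : G → ℝ) (ν : H → ℝ) : G × H → ℝ :=
  fun p => μ p.1 * ν p.2

/-- The noise kernel `π^ρ = (1-ρ)·μ^diag + ρ·(μ×μ)` on `G × G`. -/
noncomputable def noise {G : Type*} [Group G] (μ : G → ℝ) (ρ : ℝ) : G × G → ℝ :=
  fun p => (1 - ρ) * diagM μ p + ρ * prodM μ μ p

/-- The `ℓ¹` distance between two measures. -/
noncomputable def l1dist {E : Type*} (ξ₁ ξ₂ : E → ℝ) : ℝ :=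
  ∑' x, |ξ₁ x - ξ₂ x|

/-- `(G,μ)` is `ℓ¹`-noise sensitive. -/
def L1NoiseSensitive {G : Type*} [Group G] (μ : G → ℝ) : Prop :=
  ∀ ρ ∈ Set.Ioo (0 : ℝ) 1,
    Tendsto
      (fun n => l1dist (convPow (noise μ ρ) n) (prodM (convPow μ n) (convPow μ n)))
      atTop (nhds 0)

/-- Shannon entropy of a measure. -/
noncomputable def entropy {E : Type*} (ξ : E → ℝ) : ℝ :=
  -∑' x, ξ x * Real.log (ξ x)

/-- `(G,μ)` is entropy noise sensitive: `H(Y_n^ρ | X_n) / H(X_n) → 1`, where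
`H(Y_n^ρ | X_n) = H(π_n^ρ) - H(μ_n)`. -/
def EntropyNoiseSensitive {G : Type*} [Group G] (μ : G → ℝ) : Prop :=
  ∀ ρ ∈ Set.Ioo (0 : ℝ) 1,
    Tendsto
      (fun n => (entropy (convPow (noise μ ρ) n) - entropy (convPow μ n))
        / entropy (convPow μ n))
      atTop (nhds 1)

/-- A function is `μ`-harmonic. -/
def Harmonic {G : Type*} [Group G] (μ : G → ℝ) (f : G → ℝ) : Prop :=
  ∀ y, f y = ∑' x, μ x * f (y * x)

/-- `(G,μ)` is Liouville: every bounded `μ`-harmonic function is constant. -/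
def Liouville {G : Type*} [Group G] (μ : G → ℝ) : Prop :=
  ∀ f : G → ℝ, Harmonic μ f → (∃ C, ∀ g, |f g| ≤ C) → ∀ x y, f x = f y

/-- Word distance for a generating set `S`: least length of a word in `S`
evaluating to `x⁻¹ * y`. -/
noncomputable def wordDist {G : Type*} [Group G] (S : Set G) (x y : G) : ℕ :=
  sInf {n : ℕ | ∃ w : List G, w.length = n ∧ (∀ g ∈ w, g ∈ S) ∧ w.prod = x⁻¹ * y}

/-- Expected distance `E d(X_n, X'_n)` between two independent samples of law `ξ`. -/
noncomputable def spread {G : Type*} [Group G] (S : Set G) (ξ : G → ℝ) : ℝ :=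
  ∑' p : G × G, ξ p.1 * ξ p.2 * (wordDist S p.1 p.2 : ℝ)

/-- Expected distance between the two coordinates under a measure on `G × G`. -/
noncomputable def avgDist {G : Type*} [Group G] (S : Set G) (π : G × G → ℝ) : ℝ :=
  ∑' p : G × G, π p * (wordDist S p.1 p.2 : ℝ)

/-- `ν` is a coupling of `ξ₁` and `ξ₂`. -/
def IsCoupling {E₁ E₂ : Type*} (ν : E₁ × E₂ → ℝ) (ξ₁ : E₁ → ℝ) (ξ₂ : E₂ → ℝ) : Prop :=
  (∀ p, 0 ≤ ν p) ∧ (∀ x, ∑' y, ν (x, y) = ξ₁ x) ∧ (∀ y, ∑' x, ν (x, y) = ξ₂ y)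

/-- `U^s(ξ₁,ξ₂)`: infimum over couplings `ν` of `ν(d(x,y) ≥ s)`. -/
noncomputable def Ufn {E₁ E₂ : Type*} (d : E₁ → E₂ → ℝ) (s : ℝ)
    (ξ₁ : E₁ → ℝ) (ξ₂ : E₂ → ℝ) : ℝ :=
  sInf {r : ℝ | ∃ ν : E₁ × E₂ → ℝ, IsCoupling ν ξ₁ ξ₂ ∧
    r = ∑' p : E₁ × E₂, {q : E₁ × E₂ | s ≤ d q.1 q.2}.indicator ν p}

/-- The `ℓ¹` product metric on `G × G` associated to the word metric of `S`. -/
noncomputable def wordDistProd {G : Type*} [Group G] (S : Set G) :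
    G × G → G × G → ℝ :=
  fun p q => (wordDist S p.1 q.1 : ℝ) + (wordDist S p.2 q.2 : ℝ)

/-- The relators `a²`, `b²` of the infinite dihedral group. -/
def dihedralRels : Set (FreeGroup (Fin 2)) :=
  {FreeGroup.of 0 ^ 2, FreeGroup.of 1 ^ 2}

/-- The infinite dihedral group `D∞ = ⟨a, b | a² = b² = 1⟩`. -/
abbrev DInf := PresentedGroup dihedralRels

/-- The generator `a` of `D∞`. -/
def Da : DInf := PresentedGroup.of 0

/-- The generator `b` of `D∞`. -/
def Db : DInf := PresentedGroup.of 1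

/-- The simple random walk measure `μ(a) = μ(b) = 1/2` on `D∞`. -/
noncomputable def muSimple : DInf → ℝ :=
  fun g => ({Da} : Set DInf).indicator (fun _ => (1:ℝ)/2) g +
    ({Db} : Set DInf).indicator (fun _ => (1:ℝ)/2) g

/-- The lazy simple random walk measure `μ(1) = μ(a) = μ(b) = 1/3` on `D∞`. -/
noncomputable def muLazy : DInf → ℝ :=
  fun g => ({1} : Set DInf).indicator (fun _ => (1:ℝ)/3) g +
    ({Da} : Set DInf).indicator (fun _ => (1:ℝ)/3) g +
    ({Db} : Set DInf).indicator (fun _ => (1:ℝ)/3) g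


/-! ### Analytic part -/

/-- The transition operator of the distance chain on `ℤ`. -/
noncomputable def Qop (ρ : ℝ) (F : ℤ → ℝ) : ℤ → ℝ := fun d =>
  (1 - ρ) * (if Even d then F d else (F d + F (d + 2) + F (d - 2)) / 3) +
    ρ * ((3 * F d + 2 * F (d + 1) + 2 * F (d - 1) + F (d + 2) + F (d - 2)) / 9)

noncomputable def m00 (ρ t : ℝ) : ℝ := 1 - ρ + ρ / 3 + (2 * ρ / 9) * Real.cos (2 * t)
noncomputable def m01 (ρ t : ℝ) : ℝ := (4 * ρ / 9) * Real.cos t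
noncomputable def m11 (ρ t : ℝ) : ℝ :=
  (1 - ρ) * (1 / 3 + 2 / 3 * Real.cos (2 * t)) + ρ / 3 + (2 * ρ / 9) * Real.cos (2 * t)

noncomputable def cc (ρ t : ℝ) : ℕ → ℝ × ℝ
  | 0 => (1, 1)
  | n + 1 => (m00 ρ t * (cc ρ t n).1 + m01 ρ t * (cc ρ t n).2,
      m01 ρ t * (cc ρ t n).1 + m11 ρ t * (cc ρ t n).2)

theorem Qop_cos (ρ t : ℝ) (c : ℝ × ℝ) :
    Qop ρ (fun d : ℤ => (1 - (if Even d then c.1 else c.2) * Real.cos (t * d)) / t ^ 2) =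
    fun d : ℤ => (1 - (if Even d then m00 ρ t * c.1 + m01 ρ t * c.2
      else m01 ρ t * c.1 + m11 ρ t * c.2) * Real.cos (t * d)) / t ^ 2 := by
  funext d
  have e1 : Even (d + 1) ↔ ¬ Even d := by simp [Int.even_add]
  have e2 : Even (d - 1) ↔ ¬ Even d := by simp [Int.even_sub]
  have e3 : Even (d + 2) ↔ Even d := by simp [Int.even_add]
  have e4 : Even (d - 2) ↔ Even d := by simp [Int.even_sub]
  have c1 : Real.cos (t * ((d + 1 : ℤ) : ℝ)) =
      Real.cos (t * d) * Real.cos t - Real.sin (t * d) * Real.sin t := by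
    rw [← Real.cos_add]; push_cast; ring_nf
  have c2 : Real.cos (t * ((d - 1 : ℤ) : ℝ)) =
      Real.cos (t * d) * Real.cos t + Real.sin (t * d) * Real.sin t := by
    rw [← Real.cos_sub]; push_cast; ring_nf
  have c3 : Real.cos (t * ((d + 2 : ℤ) : ℝ)) =
      Real.cos (t * d) * Real.cos (2 * t) - Real.sin (t * d) * Real.sin (2 * t) := by
    rw [← Real.cos_add]; push_cast; ring_nf
  have c4 : Real.cos (t * ((d - 2 : ℤ) : ℝ)) =
      Real.cos (t * d) * Real.cos (2 * t) + Real.sin (t * d) * Real.sin (2 * t) := by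
    rw [← Real.cos_sub]; push_cast; ring_nf
  unfold Qop
  simp only [e1, e2, e3, e4, c1, c2, c3, c4, m00, m01, m11]
  by_cases h : Even d
  · simp only [h, if_true, not_true, if_false]; ring
  · simp only [h, if_false, not_false_eq_true, if_true]; ring

theorem Qop_iter_cos (ρ t : ℝ) (n : ℕ) :
    (Qop ρ)^[n] (fun d : ℤ => (1 - Real.cos (t * d)) / t ^ 2) =
    fun d : ℤ => (1 - (if Even d then (cc ρ t n).1 else (cc ρ t n).2) * Real.cos (t * d))
      / t ^ 2 := by
  induction n with
  | zero => simp [cc]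
  | succ n ih => rw [Function.iterate_succ_apply', ih, Qop_cos]; rfl

open MeasureTheory in
theorem Qop_iter_int (ρ : ℝ) (n : ℕ) (h : ℝ → ℤ → ℝ)
    (hi : ∀ d, Integrable (fun t => h t d)) (d : ℤ) :
    Integrable (fun t => (Qop ρ)^[n] (h t) d) ∧
    ∫ t, (Qop ρ)^[n] (h t) d = (Qop ρ)^[n] (fun d => ∫ t, h t d) d := by
  induction n generalizing d with
  | zero => exact ⟨hi d, rfl⟩
  | succ n ih =>
    simp only [Function.iterate_succ_apply']
    have I := fun d => (ih d).1
    have E : (Qop ρ)^[n] (fun d => ∫ t, h t d) = fun d => ∫ t, (Qop ρ)^[n] (h t) d := by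
      funext d; exact (ih d).2.symm
    rw [E]
    generalize hg : (fun t => (Qop ρ)^[n] (h t)) = g at *
    have hg' : ∀ t, (Qop ρ)^[n] (h t) = g t := fun t => congrFun hg t
    simp only [hg'] at *
    have A1 : Integrable (fun t => if Even d then g t d
        else (g t d + g t (d + 2) + g t (d - 2)) / 3) := by
      split_ifs
      · exact I d
      · exact (((I d).add (I _)).add (I _)).div_const 3
    have A2a := ((I d).const_mul 3).add ((I (d + 1)).const_mul 2)
    have A2b := A2a.add ((I (d - 1)).const_mul 2)
    have A2c := A2b.add (I (d + 2))
    have A2d := A2c.add (I (d - 2))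
    unfold Qop
    refine ⟨(A1.const_mul (1 - ρ)).add ((A2d.div_const 9).const_mul ρ), ?_⟩
    have s1 := integral_add (A1.const_mul (1 - ρ)) ((A2d.div_const 9).const_mul ρ)
    have s2 := integral_add A2c (I (d - 2))
    have s3 := integral_add A2b (I (d + 2))
    have s4 := integral_add A2a ((I (d - 1)).const_mul 2)
    have s5 := integral_add ((I d).const_mul 3) ((I (d + 1)).const_mul 2)
    have s6 := integral_add ((I d).add (I (d + 2))) (I (d - 2))
    have s7 := integral_add (I d) (I (d + 2))
    simp only [Pi.add_apply] at s1 s2 s3 s4 s5 s6 s7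
    rw [s1, integral_const_mul, integral_const_mul, integral_div, s2, s3, s4, s5]
    simp only [integral_const_mul]
    congr 1
    congr 1
    split_ifs
    · rfl
    · rw [integral_div, s6, s7]

theorem cc_contract {ρ : ℝ} (h0 : 0 ≤ ρ) (h1 : ρ ≤ 1) (t x y e : ℝ) (hx : |x| ≤ e) (hy : |y| ≤ e) :
    |m00 ρ t * x + m01 ρ t * y| ≤ e ∧ |m01 ρ t * x + m11 ρ t * y| ≤ e := by
  have he : 0 ≤ e := (abs_nonneg x).trans hx
  have hC := Real.abs_cos_le_one t
  have hD := Real.abs_cos_le_one (2 * t)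
  have b0 : |m00 ρ t| ≤ 1 - 4 * ρ / 9 := by
    unfold m00; rw [abs_le] at *; constructor <;> nlinarith
  have b1 : |m01 ρ t| ≤ 4 * ρ / 9 := by
    unfold m01; rw [abs_le] at *; constructor <;> nlinarith
  have b2 : |m11 ρ t| ≤ 1 - 4 * ρ / 9 := by
    unfold m11; rw [abs_le] at *; constructor <;> nlinarith
  have key : ∀ p q : ℝ, |p| ≤ 1 - 4 * ρ / 9 → |q| ≤ 4 * ρ / 9 → ∀ u v : ℝ, |u| ≤ e → |v| ≤ e →
      |p * u + q * v| ≤ e := by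
    intro p q hp hq u v hu hv
    calc |p * u + q * v| ≤ |p * u| + |q * v| := abs_add_le _ _
      _ = |p| * |u| + |q| * |v| := by rw [abs_mul, abs_mul]
      _ ≤ (1 - 4 * ρ / 9) * e + (4 * ρ / 9) * e := by gcongr; linarith
      _ = e := by ring
  refine ⟨key _ _ b0 b1 _ _ hx hy, ?_⟩
  rw [add_comm]; exact key _ _ b2 b1 _ _ hy hx

theorem cc_le_one {ρ : ℝ} (h0 : 0 ≤ ρ) (h1 : ρ ≤ 1) (t : ℝ) (n : ℕ) :
    |(cc ρ t n).1| ≤ 1 ∧ |(cc ρ t n).2| ≤ 1 := by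
  induction n with
  | zero => simp [cc]
  | succ n ih => exact cc_contract h0 h1 t _ _ 1 ih.1 ih.2

theorem cc_near_one {ρ : ℝ} (h0 : 0 ≤ ρ) (h1 : ρ ≤ 1) (t : ℝ) (n : ℕ) :
    |1 - (cc ρ t n).1| ≤ n * (2 * t ^ 2) ∧ |1 - (cc ρ t n).2| ≤ n * (2 * t ^ 2) := by
  induction n with
  | zero => simp [cc]
  | succ n ih =>
    have hC := Real.one_sub_sq_div_two_le_cos (x := t)
    have hD := Real.one_sub_sq_div_two_le_cos (x := 2 * t)
    have hC' := Real.cos_le_one t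
    have hD' := Real.cos_le_one (2 * t)
    obtain ⟨k1, k2⟩ := cc_contract h0 h1 t _ _ _ ih.1 ih.2
    have r1 : |1 - (m00 ρ t + m01 ρ t)| ≤ 2 * t ^ 2 := by
      unfold m00 m01; rw [abs_le]; constructor <;> nlinarith [sq_nonneg t]
    have r2 : |1 - (m01 ρ t + m11 ρ t)| ≤ 2 * t ^ 2 := by
      unfold m01 m11; rw [abs_le]
      constructor <;> nlinarith [sq_nonneg t, mul_nonneg h0 (sq_nonneg t)]
    simp only [cc]
    rw [abs_le] at k1 k2 r1 r2
    rw [abs_le, abs_le]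
    push_cast
    constructor <;> constructor <;> linarith [k1.1, k1.2, k2.1, k2.2, r1.1, r1.2, r2.1, r2.2]

theorem cc_approx {ρ : ℝ} (h0 : 0 < ρ) (h1 : ρ ≤ 1) : ∃ K B : ℝ, ∀ (t : ℝ) (n : ℕ), |t| ≤ 1 / 2 →
    |(cc ρ t n).1 - (1 - 2 / 3 * t ^ 2) ^ n| ≤ K * t ^ 2 + n * (B * t ^ 4) := by
  obtain ⟨κ, hκ⟩ : ∃ κ : ℝ, κ * ρ = -(3 / 2) * (1 - ρ) :=
    ⟨-(3 / 2) * (1 - ρ) / ρ, by field_simp⟩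
  refine ⟨|κ|, 10 * (1 + |κ|), fun t n ht => ?_⟩
  have ht2 : t ^ 2 ≤ 1 / 4 := by
    rw [← sq_abs]; nlinarith [abs_nonneg t]
  have ht0 : 0 ≤ t ^ 2 := sq_nonneg t
  obtain ⟨δ, hδ⟩ : ∃ δ, δ = Real.cos t - 1 + t ^ 2 / 2 := ⟨_, rfl⟩
  obtain ⟨ε, hε⟩ : ∃ ε, ε = Real.cos (2 * t) - 1 + 2 * t ^ 2 := ⟨_, rfl⟩
  have t4 : |t| ^ 4 = t ^ 4 := by rw [← abs_pow]; exact abs_of_nonneg (by positivity)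
  have bδ : |δ| ≤ t ^ 4 := by
    have := Real.cos_bound (x := t) (by linarith)
    rw [t4] at this
    have e : δ = Real.cos t - (1 - t ^ 2 / 2) := by rw [hδ]; ring
    rw [e]; nlinarith [sq_nonneg (t ^ 2)]
  have bε : |ε| ≤ t ^ 4 := by
    have := Real.cos_bound (x := 2 * t) (by rw [abs_mul]; norm_num; linarith)
    rw [abs_mul, mul_pow |2|, t4] at this
    have e : ε = Real.cos (2 * t) - (1 - (2 * t) ^ 2 / 2) := by rw [hε]; ring
    rw [e]; norm_num at this ⊢; nlinarith [sq_nonneg (t ^ 2)]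
  have hk1 : |1 + κ * t ^ 2| ≤ 1 + |κ| := by
    calc _ ≤ |1| + |κ * t ^ 2| := abs_add_le _ _
      _ = 1 + |κ| * t ^ 2 := by rw [abs_one, abs_mul, abs_of_nonneg ht0]
      _ ≤ _ := by nlinarith [abs_nonneg κ]
  have t4n : 0 ≤ t ^ 4 := by positivity
  have bounds : ∀ a b c : ℝ, |a| ≤ 1 → |b| ≤ 1 → |c| ≤ 3 →
      |a * δ * (1 + κ * t ^ 2) + b * ε * (1 + κ * t ^ 2) + c * (κ * t ^ 4)|
        ≤ 5 * (1 + |κ|) * t ^ 4 := by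
    intro a b c ha hb hc
    calc _ ≤ |a * δ * (1 + κ * t ^ 2)| + |b * ε * (1 + κ * t ^ 2)| + |c * (κ * t ^ 4)| :=
          abs_add_three _ _ _
      _ = |a| * |δ| * |1 + κ * t ^ 2| + |b| * |ε| * |1 + κ * t ^ 2| + |c| * (|κ| * t ^ 4) := by
          simp only [abs_mul, abs_of_nonneg t4n]
      _ ≤ 1 * t ^ 4 * (1 + |κ|) + 1 * t ^ 4 * (1 + |κ|) + 3 * (|κ| * t ^ 4) := by gcongr
      _ ≤ _ := by nlinarith [mul_nonneg (abs_nonneg κ) t4n]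
  have R1 : |m00 ρ t * 1 + m01 ρ t * (1 + κ * t ^ 2) - (1 - 2 / 3 * t ^ 2)|
      ≤ 10 * (1 + |κ|) * t ^ 4 := by
    have b1 := bounds (4 * ρ / 9) 0 (-(2 * ρ / 9)) (by rw [abs_le]; constructor <;> linarith)
      (by simp) (by rw [abs_le]; constructor <;> linarith)
    have b2 : |(2 * ρ / 9) * ε| ≤ t ^ 4 := by
      rw [abs_mul, abs_of_nonneg (by positivity)]
      nlinarith [abs_nonneg ε]
    have e : m00 ρ t * 1 + m01 ρ t * (1 + κ * t ^ 2) - (1 - 2 / 3 * t ^ 2) =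
      ((4 * ρ / 9) * δ * (1 + κ * t ^ 2) + 0 * ε * (1 + κ * t ^ 2) +
        (-(2 * ρ / 9)) * (κ * t ^ 4)) + (2 * ρ / 9) * ε := by
      unfold m00 m01; rw [hδ, hε]; linear_combination (4 / 9 * t ^ 2) * hκ
    rw [e]
    refine (abs_add_le _ _).trans ?_
    nlinarith [mul_nonneg (abs_nonneg κ) t4n]
  have R2 : |m01 ρ t * 1 + m11 ρ t * (1 + κ * t ^ 2) - (1 - 2 / 3 * t ^ 2) * (1 + κ * t ^ 2)|
      ≤ 10 * (1 + |κ|) * t ^ 4 := by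
    have b1 := bounds 0 (2 / 3 * (1 - ρ) + 2 * ρ / 9)
      (-2 * (2 / 3 * (1 - ρ) + 2 * ρ / 9) + 2 / 3) (by simp)
      (by rw [abs_le]; constructor <;> linarith) (by rw [abs_le]; constructor <;> linarith)
    have b2 : |(4 * ρ / 9) * δ| ≤ t ^ 4 := by
      rw [abs_mul, abs_of_nonneg (by positivity)]
      nlinarith [abs_nonneg δ]
    have e : m01 ρ t * 1 + m11 ρ t * (1 + κ * t ^ 2) - (1 - 2 / 3 * t ^ 2) * (1 + κ * t ^ 2) =
      (0 * δ * (1 + κ * t ^ 2) + (2 / 3 * (1 - ρ) + 2 * ρ / 9) * ε * (1 + κ * t ^ 2) +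
        (-2 * (2 / 3 * (1 - ρ) + 2 * ρ / 9) + 2 / 3) * (κ * t ^ 4)) + (4 * ρ / 9) * δ := by
      unfold m01 m11; rw [hδ, hε]; linear_combination (-4 / 9 * t ^ 2) * hκ
    rw [e]
    refine (abs_add_le _ _).trans ?_
    nlinarith [mul_nonneg (abs_nonneg κ) t4n]
  set l := 1 - 2 / 3 * t ^ 2 with hl
  have main : |(cc ρ t n).1 - l ^ n * 1| ≤ |κ| * t ^ 2 + n * (10 * (1 + |κ|) * t ^ 4) ∧
      |(cc ρ t n).2 - l ^ n * (1 + κ * t ^ 2)| ≤ |κ| * t ^ 2 + n * (10 * (1 + |κ|) * t ^ 4) := by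
    induction n with
    | zero =>
      simp only [cc, pow_zero, mul_one, sub_self, abs_zero, one_mul, Nat.cast_zero, zero_mul,
        add_zero]
      refine ⟨by positivity, ?_⟩
      rw [show 1 - (1 + κ * t ^ 2) = -(κ * t ^ 2) by ring, abs_neg, abs_mul, abs_of_nonneg ht0]
    | succ n ih =>
      obtain ⟨k1, k2⟩ := cc_contract h0.le h1 t _ _ _ ih.1 ih.2
      have ln : |l ^ n| ≤ 1 := by
        rw [abs_pow]; apply pow_le_one₀ (abs_nonneg _)
        rw [abs_le]; constructor <;> linarith
      have g : ∀ x : ℝ, |x| ≤ 10 * (1 + |κ|) * t ^ 4 → |l ^ n * x| ≤ 10 * (1 + |κ|) * t ^ 4 := by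
        intro x hx; rw [abs_mul]
        nlinarith [abs_nonneg x, abs_nonneg (l ^ n)]
      have g1 := g _ R1
      have g2 := g _ R2
      simp only [cc]
      push_cast
      constructor
      · rw [show m00 ρ t * (cc ρ t n).1 + m01 ρ t * (cc ρ t n).2 - l ^ (n + 1) * 1 =
          (m00 ρ t * ((cc ρ t n).1 - l ^ n * 1) +
            m01 ρ t * ((cc ρ t n).2 - l ^ n * (1 + κ * t ^ 2))) +
          l ^ n * (m00 ρ t * 1 + m01 ρ t * (1 + κ * t ^ 2) - l) by ring]
        refine (abs_add_le _ _).trans ?_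
        linarith
      · rw [show m01 ρ t * (cc ρ t n).1 + m11 ρ t * (cc ρ t n).2 - l ^ (n + 1) * (1 + κ * t ^ 2) =
          (m01 ρ t * ((cc ρ t n).1 - l ^ n * 1) +
            m11 ρ t * ((cc ρ t n).2 - l ^ n * (1 + κ * t ^ 2))) +
          l ^ n * (m01 ρ t * 1 + m11 ρ t * (1 + κ * t ^ 2) - l * (1 + κ * t ^ 2)) by ring]
        refine (abs_add_le _ _).trans ?_
        linarith
  simpa [mul_assoc] using main.1

/-! ### Group part -/

theorem Da_mul_self : Da * Da = 1 := by
  have h : (FreeGroup.of 0 ^ 2 : FreeGroup (Fin 2)) ∈ dihedralRels := Or.inl rfl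
  have := PresentedGroup.one_of_mem h
  rw [map_pow, pow_two] at this
  exact this

theorem Db_mul_self : Db * Db = 1 := by
  have h : (FreeGroup.of 1 ^ 2 : FreeGroup (Fin 2)) ∈ dihedralRels := Or.inr rfl
  have := PresentedGroup.one_of_mem h
  rw [map_pow, pow_two] at this
  exact this

theorem Da_inv : Da⁻¹ = Da := inv_eq_of_mul_eq_one_left Da_mul_self
theorem Db_inv : Db⁻¹ = Db := inv_eq_of_mul_eq_one_left Db_mul_self

theorem DInf_induction {p : DInf → Prop} (h1 : p 1) (ha : ∀ g, p g → p (g * Da))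
    (hb : ∀ g, p g → p (g * Db)) (g : DInf) : p g := by
  have hg : g ∈ Subgroup.closure (Set.range (PresentedGroup.of (rels := dihedralRels))) := by
    rw [PresentedGroup.closure_range_of]; trivial
  induction hg using Subgroup.closure_induction_right with
  | one => exact h1
  | mul_right x hx y hy ih =>
    obtain ⟨i, rfl⟩ := hy
    fin_cases i
    · exact ha _ ih
    · exact hb _ ih
  | mul_inv_cancel x hx y hy ih =>
    obtain ⟨i, rfl⟩ := hy
    fin_cases i
    · have := ha _ ih
      rw [← Da_inv] at this; exact this
    · have := hb _ ih
      rw [← Db_inv] at this; exact this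

/-- The left action of `D∞` on its Cayley graph `ℤ`. -/
def actHom : DInf →* Equiv.Perm ℤ :=
  PresentedGroup.toGroup (f := ![Equiv.subLeft 1, Equiv.subLeft (-1)]) (by
    rintro r (rfl | rfl)
    · ext k; simp [pow_two]
    · ext k; simp [pow_two])

theorem act_a (k : ℤ) : actHom Da k = 1 - k := by
  simp [actHom, Da]

theorem act_b (k : ℤ) : actHom Db k = -1 - k := by
  simp [actHom, Db]

/-- Position in the Cayley graph. -/
def pos (g : DInf) : ℤ := actHom g 0

theorem act_eq (g : DInf) (k : ℤ) :
    actHom g k = if Even (pos g) then pos g + k else pos g - k := by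
  induction g using DInf_induction generalizing k with
  | h1 => simp [pos]
  | ha g ih =>
    have e : pos (g * Da) = actHom g 1 := by simp [pos, act_a]
    rw [map_mul, Equiv.Perm.mul_apply, act_a, e, ih, ih]
    by_cases h : Even (pos g)
    · have : ¬ Even (pos g + 1) := by simp [Int.even_add, h]
      simp only [h, this, if_true, if_false]; ring
    · have : Even (pos g - 1) := by rw [Int.even_sub]; simp [h]
      simp only [h, this, if_true, if_false]; ring
  | hb g ih =>
    have e : pos (g * Db) = actHom g (-1) := by simp [pos, act_b]
    rw [map_mul, Equiv.Perm.mul_apply, act_b, e, ih, ih]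
    by_cases h : Even (pos g)
    · have : ¬ Even (pos g + -1) := by simp [Int.even_add, h]
      simp only [h, this, if_true, if_false]; ring
    · have : Even (pos g - -1) := by rw [Int.even_sub]; simp [h]
      simp only [h, this, if_true, if_false]; ring

theorem pos_mul_a (g : DInf) : pos (g * Da) = if Even (pos g) then pos g + 1 else pos g - 1 := by
  rw [← act_eq]; simp [pos, act_a]

theorem pos_mul_b (g : DInf) : pos (g * Db) = if Even (pos g) then pos g - 1 else pos g + 1 := by
  have := act_eq g (-1)
  rw [← sub_eq_add_neg, sub_neg_eq_add] at this
  rw [← this]; simp [pos, act_b]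

theorem pos_one : pos 1 = 0 := by simp [pos]

theorem pos_inv_mul (x y : DInf) : |pos (x⁻¹ * y)| = |pos x - pos y| := by
  have h1 : pos (x⁻¹ * y) = actHom x⁻¹ (pos y) := by simp [pos]
  have h2 : (0 : ℤ) = actHom x⁻¹ (pos x) := by simp [pos]
  have h3 : |pos (x⁻¹ * y)| = |actHom x⁻¹ (pos y) - actHom x⁻¹ (pos x)| := by
    rw [← h2, h1, sub_zero]
  rw [h3, act_eq, act_eq]
  split_ifs
  · rw [abs_sub_comm]; congr 1; ring
  · congr 1; ring

/-- Normal form. -/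
def Wn (k : ℤ) : DInf := (Da * Db) ^ (k / 2) * (if Even k then 1 else Da)

theorem Wn_mul_a (k : ℤ) : Wn k * Da = Wn (if Even k then k + 1 else k - 1) := by
  unfold Wn
  rcases Int.even_or_odd k with h | h
  · obtain ⟨m, rfl⟩ := h
    have e : ¬ Even (m + m + 1) := by simp [Int.even_add]
    have e' : Even (m + m) := ⟨m, rfl⟩
    simp only [e, e', if_true, if_false, mul_one]
    rw [show (m + m) / 2 = m by omega, show (m + m + 1) / 2 = m by omega]
  · obtain ⟨m, rfl⟩ := h
    have e : ¬ Even (2 * m + 1) := by simp [Int.even_add]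
    have e' : Even (2 * m + 1 - 1) := by simp
    simp only [e, e', if_true, if_false, mul_one]
    rw [show (2 * m + 1 - 1) / 2 = m by omega, show (2 * m + 1) / 2 = m by omega, mul_assoc,
      Da_mul_self, mul_one]

theorem Wn_mul_b (k : ℤ) : Wn k * Db = Wn (if Even k then k - 1 else k + 1) := by
  unfold Wn
  rcases Int.even_or_odd k with h | h
  · obtain ⟨m, rfl⟩ := h
    have e : ¬ Even (m + m - 1) := by simp [Int.even_sub]
    have e' : Even (m + m) := ⟨m, rfl⟩
    simp only [e, e', if_true, if_false, mul_one]
    rw [show (m + m) / 2 = m by omega, show (m + m - 1) / 2 = m - 1 by omega, zpow_sub_one,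
      mul_inv_rev, Da_inv, Db_inv, mul_assoc, mul_assoc, Da_mul_self, mul_one]
  · obtain ⟨m, rfl⟩ := h
    have e : ¬ Even (2 * m + 1) := by simp [Int.even_add]
    have e' : Even (2 * m + 1 + 1) := by simp [Int.even_add]
    simp only [e, e', if_true, if_false, mul_one]
    rw [show (2 * m + 1 + 1) / 2 = m + 1 by omega, show (2 * m + 1) / 2 = m by omega, mul_assoc,
      zpow_add_one]

theorem Wn_pos (g : DInf) : Wn (pos g) = g := by
  induction g using DInf_induction with
  | h1 => simp [pos_one, Wn]
  | ha g ih => rw [pos_mul_a, ← Wn_mul_a, ih]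
  | hb g ih => rw [pos_mul_b, ← Wn_mul_b, ih]

theorem Wn_words (n : ℕ) :
    (∃ w : List DInf, w.length = n ∧ (∀ g ∈ w, g ∈ ({Da, Db} : Set DInf)) ∧ w.prod = Wn n) ∧
    (∃ w : List DInf, w.length = n ∧ (∀ g ∈ w, g ∈ ({Da, Db} : Set DInf)) ∧ w.prod = Wn (-n)) := by
  have step : ∀ (k k' : ℤ) (n : ℕ), (k' = k + 1 ∨ k' = k - 1) →
      (∃ w : List DInf, w.length = n ∧ (∀ g ∈ w, g ∈ ({Da, Db} : Set DInf)) ∧ w.prod = Wn k) →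
      (∃ w : List DInf, w.length = n + 1 ∧ (∀ g ∈ w, g ∈ ({Da, Db} : Set DInf)) ∧
        w.prod = Wn k') := by
    rintro k k' n hk ⟨w, hl, hw, hp⟩
    have : ∃ s ∈ ({Da, Db} : Set DInf), Wn k * s = Wn k' := by
      by_cases h : Even k <;> rcases hk with rfl | rfl
      · exact ⟨Da, by simp, by simp [Wn_mul_a, h]⟩
      · exact ⟨Db, by simp, by simp [Wn_mul_b, h]⟩
      · exact ⟨Db, by simp, by simp [Wn_mul_b, h]⟩
      · exact ⟨Da, by simp, by simp [Wn_mul_a, h]⟩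
    obtain ⟨s, hs, e⟩ := this
    refine ⟨w ++ [s], by simp [hl], ?_, by simp [hp, e]⟩
    intro g hg
    rcases List.mem_append.1 hg with h | h
    · exact hw g h
    · rw [List.mem_singleton.1 h]; exact hs
  induction n with
  | zero => exact ⟨⟨[], by simp [Wn]⟩, ⟨[], by simp [Wn]⟩⟩
  | succ n ih =>
    exact ⟨step _ _ _ (Or.inl (by push_cast; ring)) ih.1,
      step _ _ _ (Or.inr (by push_cast; ring)) ih.2⟩

theorem pos_le_length (w : List DInf) (hw : ∀ g ∈ w, g ∈ ({Da, Db} : Set DInf)) :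
    |pos w.prod| ≤ w.length := by
  induction w using List.reverseRecOn with
  | nil => simp [pos_one]
  | append_singleton w s ih =>
    have i := ih (fun g hg => hw g (by simp [hg]))
    have hs := hw s (by simp)
    rw [List.prod_append, List.prod_singleton, List.length_append, List.length_singleton]
    push_cast
    rw [abs_le] at *
    rcases hs with rfl | rfl
    · rw [pos_mul_a]; split_ifs <;> constructor <;> linarith [i.1, i.2]
    · rw [pos_mul_b]; split_ifs <;> constructor <;> linarith [i.1, i.2]

theorem wordDist_eq (x y : DInf) :
    (wordDist ({Da, Db} : Set DInf) x y : ℝ) = |((pos x - pos y : ℤ) : ℝ)| := by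
  have : wordDist ({Da, Db} : Set DInf) x y = (pos (x⁻¹ * y)).natAbs := by
    have key : (pos (x⁻¹ * y)).natAbs ∈ {n : ℕ | ∃ w : List DInf, w.length = n ∧
        (∀ g ∈ w, g ∈ ({Da, Db} : Set DInf)) ∧ w.prod = x⁻¹ * y} := by
      have h := Wn_words (pos (x⁻¹ * y)).natAbs
      have e := Wn_pos (x⁻¹ * y)
      rcases Int.natAbs_eq (pos (x⁻¹ * y)) with h' | h'
      · rw [← h', e] at h; exact h.1
      · rw [← h', e] at h; exact h.2
    apply le_antisymm
    · exact Nat.sInf_le key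
    · apply le_csInf ⟨_, key⟩
      rintro n ⟨w, rfl, hw, hp⟩
      have := pos_le_length w hw
      rw [hp, Int.abs_eq_natAbs] at this
      exact_mod_cast this
  rw [this, Nat.cast_natAbs, pos_inv_mul]
  push_cast; rfl

theorem Da_ne_one : Da ≠ 1 := by
  intro h; have := act_a 0; rw [h] at this; simp at this
theorem Db_ne_one : Db ≠ 1 := by
  intro h; have := act_b 0; rw [h] at this; simp at this
theorem Da_ne_Db : Da ≠ Db := by
  intro h; have := act_a 0; rw [h, act_b] at this; simp at this

theorem tsum_muLazy (F : DInf → ℝ) : ∑' h, muLazy h * F h = (F 1 + F Da + F Db) / 3 := by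
  classical
  rw [tsum_eq_sum (s := {1, Da, Db})]
  · rw [Finset.sum_insert (by simp [Da_ne_one.symm, Db_ne_one.symm]),
      Finset.sum_insert (by simp [Da_ne_Db]), Finset.sum_singleton]
    simp [muLazy, Set.indicator, Da_ne_one, Db_ne_one, Da_ne_Db, Da_ne_one.symm, Db_ne_one.symm,
      Da_ne_Db.symm]
    ring
  · intro b hb
    simp at hb
    simp [muLazy, Set.indicator, hb]

theorem muLazy_zero {g : DInf} (h1 : g ≠ 1) (h2 : g ≠ Da) (h3 : g ≠ Db) : muLazy g = 0 := by
  simp [muLazy, Set.indicator, h1, h2, h3]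
theorem muLazy_one : muLazy 1 = 1 / 3 := by
  simp [muLazy, Set.indicator, Da_ne_one.symm, Db_ne_one.symm]
theorem muLazy_a : muLazy Da = 1 / 3 := by
  simp [muLazy, Set.indicator, Da_ne_one, Da_ne_Db]
theorem muLazy_b : muLazy Db = 1 / 3 := by
  simp [muLazy, Set.indicator, Db_ne_one, Da_ne_Db.symm]

/-- One-step average for the noisy pair. -/
noncomputable def stepAvg (ρ : ℝ) (F : DInf × DInf → ℝ) : ℝ :=
  (1 - ρ) * ((F (1, 1) + F (Da, Da) + F (Db, Db)) / 3) +
    ρ * ((F (1, 1) + F (1, Da) + F (1, Db) + F (Da, 1) + F (Da, Da) + F (Da, Db) +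
      F (Db, 1) + F (Db, Da) + F (Db, Db)) / 9)

theorem noise_zero (ρ : ℝ) (p : DInf × DInf)
    (hp : ¬ ((p.1 = 1 ∨ p.1 = Da ∨ p.1 = Db) ∧ (p.2 = 1 ∨ p.2 = Da ∨ p.2 = Db))) :
    noise muLazy ρ p = 0 := by
  have : muLazy p.1 = 0 ∨ muLazy p.2 = 0 := by
    by_contra hc
    push Not at hc
    apply hp
    constructor
    · by_contra h; push Not at h; exact hc.1 (muLazy_zero h.1 h.2.1 h.2.2)
    · by_contra h; push Not at h; exact hc.2 (muLazy_zero h.1 h.2.1 h.2.2)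
  unfold noise diagM prodM
  by_cases e : p.1 = p.2
  · have h0 : muLazy p.2 = 0 := by rw [e] at this; tauto
    simp [Set.indicator, e, h0]
  · rcases this with h | h <;> simp [Set.indicator, e, h]

theorem tsum_noise (ρ : ℝ) (F : DInf × DInf → ℝ) :
    ∑' h, noise muLazy ρ h * F h = stepAvg ρ F := by
  classical
  rw [tsum_eq_sum (s := ({1, Da, Db} : Finset DInf) ×ˢ ({1, Da, Db} : Finset DInf))]
  · rw [Finset.sum_product]
    have e : ∀ f : DInf → ℝ, ∑ x ∈ ({1, Da, Db} : Finset DInf), f x = f 1 + f Da + f Db := by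
      intro f
      rw [Finset.sum_insert (by simp [Da_ne_one.symm, Db_ne_one.symm]),
        Finset.sum_insert (by simp [Da_ne_Db]), Finset.sum_singleton]
      ring
    simp only [e]
    simp only [noise, diagM, prodM, Set.indicator, Set.mem_ofPred_eq, muLazy_one, muLazy_a,
      muLazy_b, Da_ne_one, Db_ne_one, Da_ne_Db, Da_ne_one.symm, Db_ne_one.symm,
      Da_ne_Db.symm, if_true, if_false, stepAvg]
    ring
  · intro b hb
    rw [noise_zero, zero_mul]
    simpa [Finset.mem_product] using hb

/-- Right-multiplication Markov operator. -/
noncomputable def Pop (ρ : ℝ) (F : DInf × DInf → ℝ) : DInf × DInf → ℝ :=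
  fun g => stepAvg ρ (fun h => F (g * h))

theorem Pop_left (ρ : ℝ) (F : DInf × DInf → ℝ) (h : DInf × DInf) (n : ℕ) :
    (Pop ρ)^[n] (fun g => F (h * g)) = fun g => (Pop ρ)^[n] F (h * g) := by
  induction n with
  | zero => rfl
  | succ n ih =>
    rw [Function.iterate_succ_apply', ih, Function.iterate_succ_apply']
    funext g
    simp only [Pop, mul_assoc]

theorem conv_noise (ρ : ℝ) (ν : DInf × DInf → ℝ) (g : DInf × DInf) :
    conv (noise muLazy ρ) ν g = stepAvg ρ (fun h => ν (h⁻¹ * g)) :=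
  tsum_noise ρ _

theorem hasSum_conv (ρ : ℝ) (n : ℕ) (F : DInf × DInf → ℝ) :
    HasSum (fun p => convPow (noise muLazy ρ) n p * F p) ((Pop ρ)^[n] F 1) := by
  induction n generalizing F with
  | zero =>
    have := hasSum_single (f := fun p => convPow (noise muLazy ρ) 0 p * F p) 1 (by
      intro p hp
      simp [convPow, Set.indicator, hp])
    simpa [convPow, Set.indicator] using this
  | succ n ih =>
    have H : ∀ h : DInf × DInf, HasSum (fun p => convPow (noise muLazy ρ) n (h⁻¹ * p) * F p)
        ((Pop ρ)^[n] F h) := by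
      intro h
      have := ih (fun g => F (h * g))
      rw [Pop_left] at this
      simp only [mul_one] at this
      rw [← (Equiv.mulLeft h).hasSum_iff]
      simpa [Function.comp_def] using this
    have e1 : (Pop ρ)^[n + 1] F 1 = stepAvg ρ ((Pop ρ)^[n] F) := by
      rw [Function.iterate_succ_apply']; simp [Pop]
    rw [e1]
    have e2 : (fun p => convPow (noise muLazy ρ) (n + 1) p * F p) =
        fun p => stepAvg ρ (fun h => convPow (noise muLazy ρ) n (h⁻¹ * p) * F p) := by
      funext p
      rw [convPow, conv_noise]
      unfold stepAvg
      ring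
    rw [e2]
    unfold stepAvg
    exact ((((H _).add (H _)).add (H _)).div_const 3 |>.mul_left _).add
      (((((((((((H _).add (H _)).add (H _)).add (H _)).add (H _)).add (H _)).add (H _)).add
        (H _)).add (H _)).div_const 9).mul_left _)

theorem Pop_pos (ρ : ℝ) (F : ℤ → ℝ) :
    Pop ρ (fun g => F (pos g.1 - pos g.2)) = fun g => Qop ρ F (pos g.1 - pos g.2) := by
  funext g
  obtain ⟨x, y⟩ := g
  simp only [Pop, stepAvg, Prod.mk_mul_mk, mul_one, pos_mul_a, pos_mul_b, Qop]
  generalize pos x = k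
  generalize pos y = l
  have hs : Even (k - l) ↔ (Even k ↔ Even l) := Int.even_sub
  by_cases hk : Even k <;> by_cases hl : Even l <;>
    simp only [hs, hk, hl, if_true, if_false, iff_true, iff_false, not_true, not_false_iff,
      iff_self]
  · rw [show k + 1 - (l + 1) = k - l by ring, show k - 1 - (l - 1) = k - l by ring,
      show k + 1 - (l - 1) = k - l + 2 by ring, show k - 1 - (l + 1) = k - l - 2 by ring,
      show k + 1 - l = k - l + 1 by ring, show k - 1 - l = k - l - 1 by ring,
      show k - (l + 1) = k - l - 1 by ring, show k - (l - 1) = k - l + 1 by ring]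
    ring
  · rw [show k + 1 - (l + 1) = k - l by ring, show k - 1 - (l - 1) = k - l by ring,
      show k + 1 - (l - 1) = k - l + 2 by ring, show k - 1 - (l + 1) = k - l - 2 by ring,
      show k + 1 - l = k - l + 1 by ring, show k - 1 - l = k - l - 1 by ring,
      show k - (l + 1) = k - l - 1 by ring, show k - (l - 1) = k - l + 1 by ring]
    ring
  · rw [show k + 1 - (l + 1) = k - l by ring, show k - 1 - (l - 1) = k - l by ring,
      show k + 1 - (l - 1) = k - l + 2 by ring, show k - 1 - (l + 1) = k - l - 2 by ring,
      show k + 1 - l = k - l + 1 by ring, show k - 1 - l = k - l - 1 by ring,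
      show k - (l + 1) = k - l - 1 by ring, show k - (l - 1) = k - l + 1 by ring]
    ring
  · rw [show k + 1 - (l + 1) = k - l by ring, show k - 1 - (l - 1) = k - l by ring,
      show k + 1 - (l - 1) = k - l + 2 by ring, show k - 1 - (l + 1) = k - l - 2 by ring,
      show k + 1 - l = k - l + 1 by ring, show k - 1 - l = k - l - 1 by ring,
      show k - (l + 1) = k - l - 1 by ring, show k - (l - 1) = k - l + 1 by ring]
    ring

theorem Pop_iter_pos (ρ : ℝ) (F : ℤ → ℝ) (n : ℕ) :
    (Pop ρ)^[n] (fun g => F (pos g.1 - pos g.2)) = fun g => (Qop ρ)^[n] F (pos g.1 - pos g.2) := by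
  induction n with
  | zero => rfl
  | succ n ih => rw [Function.iterate_succ_apply', ih, Pop_pos, Function.iterate_succ_apply']

/-- Mean distance as an iterate of `Qop`. -/
noncomputable def An (ρ : ℝ) (n : ℕ) : ℝ := (Qop ρ)^[n] (fun d : ℤ => |(d : ℝ)|) 0

theorem avgDist_eq (ρ : ℝ) (n : ℕ) :
    avgDist ({Da, Db} : Set DInf) (convPow (noise muLazy ρ) n) = An ρ n := by
  have h := (hasSum_conv ρ n (fun p => |((pos p.1 - pos p.2 : ℤ) : ℝ)|)).tsum_eq
  unfold avgDist An
  simp only [wordDist_eq]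
  rw [h, Pop_iter_pos ρ (fun d : ℤ => |(d : ℝ)|) n]
  simp [pos_one]

theorem convPow_prod (n : ℕ) :
    convPow (noise muLazy 1) n = prodM (convPow muLazy n) (convPow muLazy n) := by
  induction n with
  | zero =>
    funext p
    obtain ⟨x, y⟩ := p
    by_cases hx : x = 1 <;> by_cases hy : y = 1 <;>
      simp [convPow, prodM, Set.indicator, hx, hy, Prod.ext_iff]
  | succ n ih =>
    funext p
    have e : ∀ g, convPow muLazy (n + 1) g =
        (convPow muLazy n (1⁻¹ * g) + convPow muLazy n (Da⁻¹ * g) + convPow muLazy n (Db⁻¹ * g)) / 3 :=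
      fun g => tsum_muLazy (fun h => convPow muLazy n (h⁻¹ * g))
    rw [convPow, conv_noise, ih]
    simp only [prodM, e, stepAvg, Prod.fst_mul, Prod.snd_mul, Prod.fst_inv, Prod.snd_inv]
    ring

theorem spread_eq (n : ℕ) :
    spread ({Da, Db} : Set DInf) (convPow muLazy n) = An 1 n := by
  rw [← avgDist_eq, convPow_prod]; rfl

/-! ### Fourier representation and conclusion -/

theorem one_div_bound {x C s : ℝ} (hC : 0 ≤ C) (h2 : |x| ≤ 2) (hs : |x| ≤ C * s ^ 2) :
    |x / s ^ 2| ≤ (C + 2) * (1 + s ^ 2)⁻¹ := by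
  have h1 : 0 < 1 + s ^ 2 := by positivity
  rw [← div_eq_mul_inv, le_div_iff₀ h1, abs_div, abs_of_nonneg (sq_nonneg s)]
  by_cases h0 : s = 0
  · subst h0; simp; positivity
  · have hp : 0 < s ^ 2 := by positivity
    rw [div_mul_eq_mul_div, div_le_iff₀ hp]
    nlinarith

theorem one_sub_cos_bound (u : ℝ) : |1 - Real.cos u| ≤ 2 ∧ |1 - Real.cos u| ≤ 1 * u ^ 2 := by
  have a := Real.cos_le_one u
  have b := Real.neg_one_le_cos u
  have c := Real.one_sub_sq_div_two_le_cos (x := u)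
  rw [abs_of_nonneg (by linarith)]
  constructor <;> nlinarith [sq_nonneg u]

open MeasureTheory

theorem integrable_dom (C : ℝ) : Integrable (fun s : ℝ => C * (1 + s ^ 2)⁻¹) :=
  integrable_inv_one_add_sq.const_mul C

noncomputable def I0 : ℝ := ∫ u : ℝ, (1 - Real.cos u) / u ^ 2

theorem integrable_G : Integrable (fun u : ℝ => (1 - Real.cos u) / u ^ 2) := by
  refine (integrable_dom (1 + 2)).mono' (Measurable.aestronglyMeasurable (by fun_prop)) (Filter.Eventually.of_forall fun u => ?_)
  rw [Real.norm_eq_abs]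
  exact one_div_bound zero_le_one (one_sub_cos_bound u).1 (one_sub_cos_bound u).2

theorem G_scale (x : ℝ) : (fun t : ℝ => (1 - Real.cos (t * x)) / t ^ 2) =
    fun t => x ^ 2 * ((1 - Real.cos (x * t)) / (x * t) ^ 2) := by
  funext t
  by_cases hx : x = 0
  · simp [hx]
  · by_cases ht : t = 0
    · simp [ht]
    · rw [mul_comm t x]; field_simp

theorem integrable_G_scale (x : ℝ) :
    Integrable (fun t : ℝ => (1 - Real.cos (t * x)) / t ^ 2) := by
  by_cases hx : x = 0
  · simp [hx]
  · rw [G_scale]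
    exact (integrable_G.comp_mul_left' hx).const_mul _

theorem integral_G_scale (x : ℝ) :
    ∫ t : ℝ, (1 - Real.cos (t * x)) / t ^ 2 = I0 * |x| := by
  by_cases hx : x = 0
  · simp [hx]
  · rw [G_scale, integral_const_mul,
      Measure.integral_comp_mul_left (fun u : ℝ => (1 - Real.cos u) / u ^ 2) x]
    have : 0 < |x| := abs_pos.2 hx
    rw [smul_eq_mul, abs_inv, ← sq_abs x]
    unfold I0
    field_simp

theorem Qop_iter_smul (ρ c : ℝ) (F : ℤ → ℝ) (n : ℕ) :
    (Qop ρ)^[n] (fun d => c * F d) = fun d => c * (Qop ρ)^[n] F d := by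
  induction n with
  | zero => rfl
  | succ n ih =>
    rw [Function.iterate_succ_apply', ih, Function.iterate_succ_apply']
    funext d
    unfold Qop
    split_ifs <;> ring

theorem An_fourier (ρ : ℝ) (n : ℕ) :
    I0 * An ρ n = ∫ t : ℝ, (1 - (cc ρ t n).1) / t ^ 2 := by
  have h := (Qop_iter_int ρ n (fun t d => (1 - Real.cos (t * d)) / t ^ 2)
    (fun d => integrable_G_scale d) 0).2
  simp only [Qop_iter_cos, integral_G_scale] at h
  rw [Qop_iter_smul ρ I0 (fun d : ℤ => |(d : ℝ)|) n] at h
  simp only [Even.zero, if_true, Int.cast_zero, mul_zero, Real.cos_zero, mul_one] at h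
  exact h.symm

theorem An_scaled (ρ : ℝ) (n : ℕ) (hn : 0 < n) :
    I0 * An ρ n / √n = ∫ s : ℝ, (1 - (cc ρ (s / √n) n).1) / s ^ 2 := by
  have hq : 0 < √(n : ℝ) := Real.sqrt_pos.2 (by exact_mod_cast hn)
  have h := Measure.integral_comp_div (fun t : ℝ => (1 - (cc ρ t n).1) / t ^ 2) (√(n : ℝ))
  rw [← An_fourier, smul_eq_mul, abs_of_pos hq] at h
  have e : (fun s : ℝ => (1 - (cc ρ (s / √n) n).1) / (s / √n) ^ 2) =
      fun s => (√n) ^ 2 * ((1 - (cc ρ (s / √n) n).1) / s ^ 2) := by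
    funext s
    rw [div_pow, div_div_eq_mul_div]; ring
  rw [e, integral_const_mul] at h
  field_simp
  have : √(n : ℝ) * (√n * ∫ s : ℝ, (1 - (cc ρ (s / √n) n).1) / s ^ 2) = √n * (I0 * An ρ n) := by
    rw [← h]; ring
  have := mul_left_cancel₀ hq.ne' this
  rw [← this]

theorem cc_continuous (ρ : ℝ) (n : ℕ) :
    Continuous (fun t => (cc ρ t n).1) ∧ Continuous (fun t => (cc ρ t n).2) := by
  induction n with
  | zero => simp only [cc]; exact ⟨continuous_const, continuous_const⟩
  | succ n ih =>
    obtain ⟨h1, h2⟩ := ih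
    simp only [cc, m00, m01, m11]
    constructor <;> fun_prop

theorem cc_limit {ρ : ℝ} (h0 : 0 < ρ) (h1 : ρ ≤ 1) (s : ℝ) :
    Tendsto (fun n : ℕ => (cc ρ (s / √n) n).1) atTop (nhds (Real.exp (-(2 / 3 * s ^ 2)))) := by
  obtain ⟨K, B, h⟩ := cc_approx h0 h1
  have hinv : Tendsto (fun n : ℕ => (1 : ℝ) / n) atTop (nhds 0) := tendsto_one_div_atTop_nhds_zero_nat
  have hsq : Tendsto (fun n : ℕ => s / √(n : ℝ)) atTop (nhds 0) :=
    Tendsto.div_atTop tendsto_const_nhds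
      (Real.tendsto_sqrt_atTop.comp tendsto_natCast_atTop_atTop)
  have hev : ∀ᶠ n : ℕ in atTop, |s / √(n : ℝ)| ≤ 1 / 2 := by
    have := hsq.abs
    rw [abs_zero] at this
    exact this.eventually_le_const (by norm_num)
  have hexp := Real.tendsto_one_add_div_pow_exp (-(2 / 3 * s ^ 2))
  have hdiff : Tendsto (fun n : ℕ => (cc ρ (s / √n) n).1 - (1 + -(2 / 3 * s ^ 2) / (n : ℝ)) ^ n)
      atTop (nhds 0) := by
    have hb : Tendsto (fun n : ℕ => (K * s ^ 2 + B * s ^ 4) * ((1 : ℝ) / n)) atTop (nhds 0) := by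
      simpa using hinv.const_mul (K * s ^ 2 + B * s ^ 4)
    refine squeeze_zero_norm' ?_ hb
    filter_upwards [hev, eventually_gt_atTop 0] with n hn hp
    have hn' := h _ n hn
    have hp' : (0 : ℝ) < n := by exact_mod_cast hp
    have e2 : (s / √(n : ℝ)) ^ 2 = s ^ 2 / n := by rw [div_pow, Real.sq_sqrt hp'.le]
    have e4 : (s / √(n : ℝ)) ^ 4 = s ^ 4 / n ^ 2 := by
      rw [show (s / √(n : ℝ)) ^ 4 = ((s / √(n : ℝ)) ^ 2) ^ 2 by ring, e2]; ring
    rw [e2, e4] at hn'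
    rw [Real.norm_eq_abs]
    have e5 : 1 + -(2 / 3 * s ^ 2) / (n : ℝ) = 1 - 2 / 3 * (s ^ 2 / n) := by ring
    rw [e5]
    refine hn'.trans (le_of_eq ?_)
    field_simp
  simpa using hdiff.add hexp

noncomputable def J0 : ℝ := ∫ s : ℝ, (1 - Real.exp (-(2 / 3 * s ^ 2))) / s ^ 2

theorem J0_pos : 0 < J0 := by
  have hnn : ∀ s : ℝ, 0 ≤ 1 - Real.exp (-(2 / 3 * s ^ 2)) := by
    intro s
    have : Real.exp (-(2 / 3 * s ^ 2)) ≤ 1 := Real.exp_le_one_iff.2 (by nlinarith [sq_nonneg s])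
    linarith
  have hI : Integrable (fun s : ℝ => (1 - Real.exp (-(2 / 3 * s ^ 2))) / s ^ 2) := by
    refine (integrable_dom (1 + 2)).mono' (Measurable.aestronglyMeasurable (by fun_prop)) (Filter.Eventually.of_forall fun u => ?_)
    rw [Real.norm_eq_abs]
    have a := Real.exp_pos (-(2 / 3 * u ^ 2))
    have b := Real.add_one_le_exp (-(2 / 3 * u ^ 2))
    refine one_div_bound zero_le_one ?_ ?_ <;> rw [abs_of_nonneg (hnn u)] <;>
      nlinarith [sq_nonneg u]
  unfold J0
  rw [integral_pos_iff_support_of_nonneg (fun s => div_nonneg (hnn s) (sq_nonneg s)) hI]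
  have hsub : Set.Ioo (0 : ℝ) 1 ⊆
      Function.support (fun s : ℝ => (1 - Real.exp (-(2 / 3 * s ^ 2))) / s ^ 2) := by
    intro s hs
    have hs2 : 0 < s ^ 2 := pow_pos hs.1 2
    have : Real.exp (-(2 / 3 * s ^ 2)) < 1 := by
      rw [← Real.exp_zero]; exact Real.exp_lt_exp.2 (by linarith)
    exact (div_pos (by linarith) hs2).ne'
  refine lt_of_lt_of_le ?_ (measure_mono hsub)
  simp

theorem An_tendsto {ρ : ℝ} (h0 : 0 < ρ) (h1 : ρ ≤ 1) :
    Tendsto (fun n : ℕ => I0 * An ρ n / √n) atTop (nhds J0) := by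
  have key : Tendsto (fun n : ℕ => ∫ s : ℝ, (1 - (cc ρ (s / √n) n).1) / s ^ 2) atTop (nhds J0) := by
    unfold J0
    refine tendsto_integral_of_dominated_convergence (fun s => (2 + 2) * (1 + s ^ 2)⁻¹) ?_
      (integrable_dom (2 + 2)) ?_ ?_
    · intro n
      have hc : Continuous (fun s : ℝ => 1 - (cc ρ (s / √n) n).1) :=
        continuous_const.sub ((cc_continuous ρ n).1.comp (continuous_id.div_const _))
      exact (hc.measurable.div (by fun_prop)).aestronglyMeasurable
    · intro n
      refine Filter.Eventually.of_forall fun s => ?_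
      rw [Real.norm_eq_abs]
      refine one_div_bound (by norm_num) ?_ ?_
      · have := (cc_le_one h0.le h1 (s / √n) n).1
        rw [abs_le] at *
        constructor <;> linarith [this.1, this.2]
      · refine (cc_near_one h0.le h1 (s / √n) n).1.trans ?_
        rw [div_pow, Real.sq_sqrt (Nat.cast_nonneg n)]
        rcases Nat.eq_zero_or_pos n with rfl | hp
        · simp; positivity
        · have hp' : (0 : ℝ) < n := by exact_mod_cast hp
          apply le_of_eq; field_simp
    · refine Filter.Eventually.of_forall fun s => ?_
      exact (tendsto_const_nhds.sub (cc_limit h0 h1 s)).div_const _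
  refine key.congr' ?_
  filter_upwards [eventually_gt_atTop 0] with n hn
  exact (An_scaled ρ n hn).symm

theorem ratio_tendsto {ρ : ℝ} (h0 : 0 < ρ) (h1 : ρ ≤ 1) :
    Tendsto (fun n : ℕ => An ρ n / An 1 n) atTop (nhds 1) := by
  have a := (An_tendsto h0 h1).div (An_tendsto one_pos le_rfl) J0_pos.ne'
  rw [div_self J0_pos.ne'] at a
  refine a.congr' ?_
  filter_upwards [eventually_gt_atTop 0,
    (An_tendsto one_pos le_rfl).eventually (lt_mem_nhds J0_pos)] with n hn hpos
  have hq : √(n : ℝ) ≠ 0 := (Real.sqrt_pos.2 (by exact_mod_cast hn)).ne'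
  have hI : I0 ≠ 0 := by
    intro h; rw [h] at hpos; simp at hpos
  simp only [Pi.div_apply]
  rw [div_div_div_cancel_right₀ hq, mul_div_mul_left _ _ hI]

/-- The lazy simple random walk on the infinite dihedral
group is noise sensitive in average word distance (for the generating set
`{a, b}`). -/
theorem dihedral_lazy_avgDistNS :
    ∀ ρ ∈ Set.Ioo (0 : ℝ) 1,
      1 ≤ Filter.liminf
        (fun n => avgDist ({Da, Db} : Set DInf) (convPow (noise muLazy ρ) n) /
          spread ({Da, Db} : Set DInf) (convPow muLazy n)) atTop := by
  intro ρ hρ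
  simp only [avgDist_eq, spread_eq]
  exact (ratio_tendsto hρ.1 hρ.2.le).liminf_eq.ge

end NS
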